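/- For X ∈ sp(2n,ℝ), the centralizer {S ∈ Sp(2n,ℝ) : SX = XS} is compact if and only if there exists exactly one matrix J ∈ M_{2n}(ℝ) such that J² = -I, the matrix ΩJ is symmetric and positive definite, and XJ = JX. (That is, X is strongly stable if and only if X leaves invariant a unique compatible positive complex structure on ℝ^{2n}.) -/

import Mathlib

open Matrix

/-- The standard symplectic form matrix `Ω = [[0, Iₙ], [-Iₙ, 0]]` on `ℝ²ⁿ`
(coordinates indexed by `Fin n ⊕ Fin n`). -/
noncomputable def Omega (n : ℕ) : Matrix (Fin n ⊕ Fin n) (Fin n ⊕ Fin n) ℝ :=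
  Matrix.fromBlocks 0 1 (-1) 0

/-- The real symplectic group `Sp(2n, ℝ) = {S : Sᵀ Ω S = Ω}`. -/
noncomputable def Sp (n : ℕ) : Set (Matrix (Fin n ⊕ Fin n) (Fin n ⊕ Fin n) ℝ) :=
  {S | Sᵀ * Omega n * S = Omega n}

/-- The symplectic Lie algebra `sp(2n, ℝ) = {X : Xᵀ Ω + Ω X = 0}`. -/
noncomputable def sp (n : ℕ) : Set (Matrix (Fin n ⊕ Fin n) (Fin n ⊕ Fin n) ℝ) :=
  {X | Xᵀ * Omega n + Omega n * X = 0}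

section Symplectic

variable {ι : Type*} [Fintype ι]

theorem Matrix.dotProduct_mulVec_sub_of_selfAdjoint {G P : Matrix ι ι ℝ} (hG : Gᵀ = G)
    (hP : Pᵀ * G = G * P) (x : ι → ℝ) :
    ((P * P) *ᵥ x - x) ⬝ᵥ G *ᵥ ((P * P) *ᵥ x - x) =
      ((P * P) *ᵥ x) ⬝ᵥ G *ᵥ ((P * P) *ᵥ x) + x ⬝ᵥ G *ᵥ x - 2 * ((P *ᵥ x) ⬝ᵥ G *ᵥ (P *ᵥ x)) := by
  have hsymm : ∀ y z : ι → ℝ, y ⬝ᵥ G *ᵥ z = z ⬝ᵥ G *ᵥ y := fun y z ↦ by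
    rw [dotProduct_mulVec, ← mulVec_transpose, hG, dotProduct_comm]
  have hcross : x ⬝ᵥ G *ᵥ ((P * P) *ᵥ x) = (P *ᵥ x) ⬝ᵥ G *ᵥ (P *ᵥ x) := by
    rw [mulVec_mulVec, ← mul_assoc, ← hP, mul_assoc, ← mulVec_mulVec,
      dotProduct_transpose_mulVec, dotProduct_comm, ← mulVec_mulVec]
  rw [mulVec_sub, dotProduct_sub, sub_dotProduct, sub_dotProduct, hsymm _ x, hcross]
  ring

theorem transpose_mul_of_isCompatible {Ω J : Matrix ι ι ℝ} (hskew : Ωᵀ = -Ω)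
    (hJt : (Ω * J)ᵀ = Ω * J) :
    Jᵀ * Ω = -(Ω * J) := by
  rw [← hJt, transpose_mul, hskew, mul_neg, neg_neg]

variable [DecidableEq ι]

open scoped MatrixOrder in
theorem Matrix.PosDef.exists_sqrt {M : Matrix ι ι ℝ} (hM : M.PosDef) :
    ∃ R : Matrix ι ι ℝ, R.PosDef ∧ R * R = M ∧ ∀ Y, Commute M Y → Commute R Y := by
  have h0 : 0 ≤ M := nonneg_iff_posSemidef.2 hM.posSemidef
  have hR : CFC.sqrt M * CFC.sqrt M = M := CFC.sqrt_mul_sqrt_self M h0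
  refine ⟨CFC.sqrt M, ?_, hR, fun Y hY ↦ ?_⟩
  · have hs : (CFC.sqrt M).PosSemidef := nonneg_iff_posSemidef.1 (CFC.sqrt_nonneg M)
    refine hs.posDef_iff_isUnit.2 ?_
    exact ((Commute.refl _).isUnit_mul_iff.1 (by rw [hR]; exact hM.isUnit)).1
  · rw [CFC.sqrt_eq_cfc]
    exact hY.cfc_nnreal _

theorem Matrix.exists_complex_structure_of_skew {A : Matrix ι ι ℝ} (hskew : Aᵀ = -A)
    (hA : IsUnit A) :
    ∃ J : Matrix ι ι ℝ, J * J = -1 ∧ (A * J).PosDef ∧ ∀ Y, Commute A Y → Commute J Y := by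
  have hM : (Aᵀ * A).PosDef := by
    simpa using PosDef.conjTranspose_mul_self A (mulVec_injective_of_isUnit hA)
  obtain ⟨R, hR, hRR, hcomm⟩ := hM.exists_sqrt
  have hMA : ∀ Y, Commute A Y → Commute R Y := fun Y hY ↦
    hcomm Y (by rw [hskew]; exact hY.neg_left.mul_left hY)
  obtain ⟨u, rfl⟩ := hA
  refine ⟨↑u⁻¹ * R, ?_, by simpa using hR, fun Y hY ↦
    Commute.mul_left hY.units_inv_left (hMA Y hY)⟩
  have h1 : Commute R (↑u⁻¹ : Matrix ι ι ℝ) := (hMA u (Commute.refl _)).units_inv_right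
  calc (↑u⁻¹ * R) * (↑u⁻¹ * R) = ↑u⁻¹ * (R * ↑u⁻¹) * R := by simp only [mul_assoc]
    _ = ↑u⁻¹ * ↑u⁻¹ * (R * R) := by rw [h1.eq]; simp only [mul_assoc]
    _ = -1 := by rw [hRR, hskew]; simp [mul_assoc]

theorem Matrix.PosDef.exists_compatible_complex_structure {Ω G X : Matrix ι ι ℝ}
    (hG : G.PosDef) (hskew : Ωᵀ = -Ω) (hΩ : IsUnit Ω) (hX : Xᵀ * Ω + Ω * X = 0)
    (hXG : Xᵀ * G + G * X = 0) :
    ∃ J : Matrix ι ι ℝ, J * J = -1 ∧ (Ω * J).PosDef ∧ X * J = J * X := by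
  obtain ⟨B, hB, rfl, -⟩ := hG.exists_sqrt
  have hBt : Bᵀ = B := by simpa using hB.isHermitian.eq
  obtain ⟨u, hu⟩ := hB.isUnit
  obtain ⟨C, hC⟩ : ∃ C, C = (↑u⁻¹ : Matrix ι ι ℝ) := ⟨_, rfl⟩
  have hBC : B * C = 1 := by rw [hC, ← hu]; simp
  have hCB : C * B = 1 := by rw [hC, ← hu]; simp
  have hCu : IsUnit C := hC ▸ Units.isUnit _
  have hCt : Cᵀ = C := by
    have h : Cᵀ * B = 1 := by rw [← hBt, ← transpose_mul, hBC, transpose_one]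
    calc Cᵀ = Cᵀ * B * C := by rw [mul_assoc, hBC, mul_one]
      _ = C := by rw [h, one_mul]
  have hBC' : ∀ Z, B * (C * Z) = Z := fun Z ↦ by rw [← mul_assoc, hBC, one_mul]
  have hCB' : ∀ Z, C * (B * Z) = Z := fun Z ↦ by rw [← mul_assoc, hCB, one_mul]
  obtain ⟨J, hJ, hpos, hcomm⟩ := exists_complex_structure_of_skew (A := C * Ω * C)
    (by simp [transpose_mul, hCt, hskew, mul_assoc]) ((hCu.mul hΩ).mul hCu)
  have hXC : X * (C * C) = -(C * C * Xᵀ) := by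
    have h := congrArg (fun Z ↦ C * (C * (Z * (C * C)))) hXG
    simp only [add_mul, mul_add, mul_assoc, hBC', hBC, hCB', mul_one, mul_zero, zero_mul] at h
    rw [mul_assoc]
    exact eq_neg_of_add_eq_zero_right h
  have hY : Commute (C * Ω * C) (B * X * C) := by
    have h : B * (X * (C * C)) * Ω = C * Ω * X := by
      rw [hXC, mul_neg, neg_mul]
      simp only [mul_assoc, hBC']
      rw [eq_neg_of_add_eq_zero_left hX, mul_neg, neg_neg]
    calc (C * Ω * C) * (B * X * C) = C * Ω * X * C := by simp only [mul_assoc, hCB']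
      _ = _ := by rw [← h]; simp only [mul_assoc]
  refine ⟨C * J * B, ?_, ?_, ?_⟩
  · calc C * J * B * (C * J * B) = C * (J * J) * B := by simp only [mul_assoc, hBC']
      _ = -1 := by rw [hJ]; simp [hCB]
  · have h := hpos.conjTranspose_mul_mul_same (mulVec_injective_of_isUnit hB.isUnit)
    rw [conjTranspose_eq_transpose_of_trivial, hBt] at h
    simpa only [mul_assoc, hBC'] using h
  · have h := congrArg (fun Z ↦ C * Z * B) (hcomm _ hY).eq
    simp only [mul_assoc, hCB', hCB, mul_one] at h
    simpa only [mul_assoc] using h.symm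

theorem Matrix.exists_posDef_invariant {K : Set (Matrix ι ι ℝ)} (hK : IsCompact K)
    (hu : ∀ s ∈ K, IsUnit s) {S : Matrix ι ι ℝ} (hS : ∀ k : ℕ, S ^ k ∈ K) :
    ∃ G : Matrix ι ι ℝ, G.PosDef ∧ Sᵀ * G * S = G := by
  have hcontS : Continuous fun G : Matrix ι ι ℝ ↦ Sᵀ * G * S - G := by fun_prop
  let _ : NormedAddCommGroup (Matrix ι ι ℝ) := Matrix.normedAddCommGroup
  let _ : NormedSpace ℝ (Matrix ι ι ℝ) := Matrix.normedSpace
  have himage : IsCompact ((fun s : Matrix ι ι ℝ ↦ sᵀ * s) '' K) :=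
    hK.image (by fun_prop)
  have hpos : ∀ x : ι → ℝ, x ≠ 0 → ∃ m : ℝ, 0 < m ∧
      convexHull ℝ ((fun s : Matrix ι ι ℝ ↦ sᵀ * s) '' K) ⊆ {G | m ≤ x ⬝ᵥ G *ᵥ x} := by
    intro x hx
    obtain ⟨s₀, hs₀, hmin⟩ := himage.exists_isMinOn ⟨_, _, hS 0, rfl⟩
      (f := fun G : Matrix ι ι ℝ ↦ x ⬝ᵥ G *ᵥ x) (by fun_prop)
    refine ⟨x ⬝ᵥ s₀ *ᵥ x, ?_, convexHull_min (fun G hG ↦ hmin hG) ?_⟩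
    · obtain ⟨s, hs, rfl⟩ := hs₀
      have h := PosDef.conjTranspose_mul_self s (mulVec_injective_of_isUnit (hu s hs))
      simpa using h.dotProduct_mulVec_pos hx
    · refine convex_halfSpace_ge ⟨fun P Q ↦ ?_, fun a P ↦ ?_⟩ _
      · rw [add_mulVec, dotProduct_add]
      · rw [smul_mulVec, dotProduct_smul]
  have hsymm : convexHull ℝ ((fun s : Matrix ι ι ℝ ↦ sᵀ * s) '' K) ⊆ {G | Gᵀ = G} := by
    refine convexHull_min ?_ fun P hP Q hQ a b _ _ _ ↦ ?_
    · rintro _ ⟨s, -, rfl⟩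
      simp [transpose_mul]
    · simp_all
  set z : ℕ → Matrix ι ι ℝ := fun k ↦ (S ^ k)ᵀ * S ^ k with hz
  have hzK : ∀ k, z k ∈ (fun s : Matrix ι ι ℝ ↦ sᵀ * s) '' K := fun k ↦ ⟨_, hS k, rfl⟩
  set avg : ℕ → Matrix ι ι ℝ := fun N ↦ ∑ k ∈ Finset.range (N + 1), (1 / ((N : ℝ) + 1)) • z k
    with havg
  have hmem : ∀ N, avg N ∈ convexHull ℝ ((fun s : Matrix ι ι ℝ ↦ sᵀ * s) '' K) := fun N ↦
    (convex_convexHull ℝ _).sum_mem (fun _ _ ↦ by positivity)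
      (by simp; field_simp) (fun k _ ↦ subset_convexHull ℝ _ (hzK k))
  obtain ⟨G, -, φ, hφ, hlim⟩ :=
    tendsto_subseq_of_bounded (isBounded_convexHull.2 himage.isBounded) hmem
  refine ⟨G, PosDef.of_dotProduct_mulVec_pos ?_ fun x hx ↦ ?_, ?_⟩
  · rw [IsHermitian, conjTranspose_eq_transpose_of_trivial]
    exact (isClosed_eq (continuous_id.matrix_transpose) continuous_id).mem_of_tendsto hlim
      (.of_forall fun k ↦ hsymm (hmem _))
  · obtain ⟨m, hm, hle⟩ := hpos x hx
    have hcont : Continuous fun G : Matrix ι ι ℝ ↦ x ⬝ᵥ G *ᵥ x := by fun_prop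
    have h : m ≤ x ⬝ᵥ G *ᵥ x :=
      ge_of_tendsto ((hcont.tendsto G).comp hlim) (.of_forall fun k ↦ hle (hmem _))
    simpa using hm.trans_le h
  have hdiff : ∀ N, Sᵀ * avg N * S - avg N = (1 / ((N : ℝ) + 1)) • (z (N + 1) - z 0) := by
    intro N
    have hstep : ∀ k, Sᵀ * z k * S = z (k + 1) := fun k ↦ by
      simp only [hz, pow_succ, transpose_mul, mul_assoc]
    rw [havg]
    simp only [← Finset.smul_sum]
    rw [mul_smul_comm, smul_mul_assoc, ← smul_sub, Finset.mul_sum, Finset.sum_mul]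
    simp only [hstep]
    rw [← Finset.sum_sub_distrib, Finset.sum_range_sub]
  obtain ⟨c, hc⟩ := isBounded_iff_forall_norm_le.1 himage.isBounded
  have hzero : Filter.Tendsto (fun N ↦ Sᵀ * avg N * S - avg N) Filter.atTop (nhds 0) := by
    simp only [hdiff]
    refine NormedField.tendsto_zero_smul_of_tendsto_zero_of_bounded
      (tendsto_one_div_add_atTop_nhds_zero_nat (𝕜 := ℝ)) ?_
    refine Filter.isBoundedUnder_of ⟨c + c, fun N ↦ (norm_sub_le _ _).trans ?_⟩
    exact add_le_add (hc _ (hzK _)) (hc _ (hzK _))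
  have hlim' : Filter.Tendsto (fun k ↦ Sᵀ * avg (φ k) * S - avg (φ k)) Filter.atTop
      (nhds (Sᵀ * G * S - G)) :=
    (hcontS.tendsto G).comp hlim
  exact sub_eq_zero.1 (tendsto_nhds_unique hlim' (hzero.comp hφ.tendsto_atTop))

theorem Matrix.exists_isUnit_one_add_smul (X : Matrix ι ι ℝ) :
    ∃ t : ℝ, t ≠ 0 ∧ IsUnit (1 + t • X) := by
  have hc : Continuous fun t : ℝ ↦ (1 + t • X).det := by fun_prop
  have h0 : ∀ᶠ t in nhds (0 : ℝ), (1 + t • X).det ≠ 0 :=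
    hc.continuousAt.eventually_ne (by simp)
  obtain ⟨t, ht, ht0⟩ :=
    ((h0.filter_mono nhdsWithin_le_nhds).and (self_mem_nhdsWithin (s := {(0 : ℝ)}ᶜ))).exists
  exact ⟨t, ht0, (isUnit_iff_isUnit_det _).2 ht.isUnit⟩

theorem le_of_convex_of_bddAbove {b : ℕ → ℝ} {c : ℝ}
    (hconv : ∀ k, 2 * b (k + 1) ≤ b k + b (k + 2)) (hc : ∀ k, b k ≤ c) : b 1 ≤ b 0 := by
  have hstep : ∀ k, b 1 - b 0 ≤ b (k + 1) - b k := by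
    intro k
    induction k with
    | zero => simp
    | succ k ih => linarith [hconv k]
  have hlin : ∀ k : ℕ, b 0 + k * (b 1 - b 0) ≤ b k := by
    intro k
    induction k with
    | zero => simp
    | succ k ih => push_cast; linarith [hstep k]
  by_contra! h
  obtain ⟨k, hk⟩ := exists_nat_gt ((c - b 0) / (b 1 - b 0))
  rw [div_lt_iff₀ (sub_pos.2 h)] at hk
  linarith [hlin k, hc k]

theorem Matrix.PosDef.dotProduct_mulVec_le_of_pow_mem {G P : Matrix ι ι ℝ} (hG : G.PosDef)
    (hP : Pᵀ * G = G * P) {K : Set (Matrix ι ι ℝ)} (hK : IsCompact K) (hPK : ∀ k : ℕ, P ^ k ∈ K)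
    (x : ι → ℝ) : (P *ᵥ x) ⬝ᵥ G *ᵥ (P *ᵥ x) ≤ x ⬝ᵥ G *ᵥ x := by
  have hGt : Gᵀ = G := by simpa using hG.isHermitian.eq
  have hcont : Continuous fun S : Matrix ι ι ℝ ↦ (S *ᵥ x) ⬝ᵥ G *ᵥ (S *ᵥ x) := by fun_prop
  obtain ⟨c, hc⟩ := (hK.image hcont).bddAbove
  have h := le_of_convex_of_bddAbove (b := fun k ↦ ((P ^ k) *ᵥ x) ⬝ᵥ G *ᵥ ((P ^ k) *ᵥ x)) (c := c)
    (fun k ↦ ?_) (fun k ↦ hc ⟨_, hPK k, rfl⟩)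
  · simpa using h
  · have h := dotProduct_mulVec_sub_of_selfAdjoint hGt hP ((P ^ k) *ᵥ x)
    have h0 := hG.posSemidef.dotProduct_mulVec_nonneg ((P * P) *ᵥ ((P ^ k) *ᵥ x) - (P ^ k) *ᵥ x)
    rw [star_trivial, h] at h0
    have h1 : (P * P) *ᵥ ((P ^ k) *ᵥ x) = (P ^ (k + 2)) *ᵥ x := by
      rw [mulVec_mulVec, mul_assoc, ← pow_succ', ← pow_succ']
    have h2 : P *ᵥ ((P ^ k) *ᵥ x) = (P ^ (k + 1)) *ᵥ x := by rw [mulVec_mulVec, ← pow_succ']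
    rw [h1, h2] at h0
    linarith

theorem Matrix.PosDef.mul_self_eq_one_of_pow_mem {G P Q : Matrix ι ι ℝ} (hG : G.PosDef)
    (hP : Pᵀ * G = G * P) (hPQ : P * Q = 1) {K : Set (Matrix ι ι ℝ)} (hK : IsCompact K)
    (hPK : ∀ k : ℕ, P ^ k ∈ K) (hQK : ∀ k : ℕ, Q ^ k ∈ K) : P * P = 1 := by
  have hGt : Gᵀ = G := by simpa using hG.isHermitian.eq
  have hQP : Q * P = 1 := mul_eq_one_comm.1 hPQ
  have hQ : Qᵀ * G = G * Q := by
    calc Qᵀ * G = Qᵀ * (G * P) * Q := by rw [mul_assoc, mul_assoc, hPQ, mul_one]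
      _ = (P * Q)ᵀ * (G * Q) := by rw [← hP, transpose_mul]; simp only [mul_assoc]
      _ = G * Q := by rw [hPQ, transpose_one, one_mul]
  have hiso : ∀ x, (P *ᵥ x) ⬝ᵥ G *ᵥ (P *ᵥ x) = x ⬝ᵥ G *ᵥ x := fun x ↦
    (hG.dotProduct_mulVec_le_of_pow_mem hP hK hPK x).antisymm <| by
      simpa [mulVec_mulVec, hQP] using hG.dotProduct_mulVec_le_of_pow_mem hQ hK hQK (P *ᵥ x)
  refine ext_of_mulVec_single fun i ↦ ?_
  rw [one_mulVec]
  by_contra hne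
  have hpos := hG.dotProduct_mulVec_pos (sub_ne_zero.2 hne)
  rw [star_trivial, dotProduct_mulVec_sub_of_selfAdjoint hGt hP, ← mulVec_mulVec, hiso, hiso]
    at hpos
  linarith

/-- The centralizer of `X` in the isometry group of the bilinear form with matrix `Ω`. -/
def isometryCentralizer (Ω X : Matrix ι ι ℝ) : Submonoid (Matrix ι ι ℝ) where
  carrier := {S | Sᵀ * Ω * S = Ω ∧ S * X = X * S}
  one_mem' := by simp
  mul_mem' := by
    rintro S T ⟨hS, hSX⟩ ⟨hT, hTX⟩
    refine ⟨?_, ?_⟩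
    · calc (S * T)ᵀ * Ω * (S * T) = Tᵀ * (Sᵀ * Ω * S) * T := by
            rw [transpose_mul]; simp only [mul_assoc]
        _ = Ω := by rw [hS, hT]
    · rw [mul_assoc, hTX, ← mul_assoc, hSX, mul_assoc]

variable {Ω X J J' S : Matrix ι ι ℝ}

theorem isUnit_of_mem_isometryCentralizer (hΩ : Ω * Ω = -1) (hS : S ∈ isometryCentralizer Ω X) :
    IsUnit S := by
  refine IsUnit.of_mul_eq_one_right (-Ω * Sᵀ * Ω) ?_
  rw [mul_assoc, mul_assoc, ← mul_assoc Sᵀ, hS.1, neg_mul, hΩ, neg_neg]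

theorem exists_cayley_mem_isometryCentralizer (hX : Xᵀ * Ω + Ω * X = 0) :
    ∃ S ∈ isometryCentralizer Ω X, ∀ G : Matrix ι ι ℝ, Sᵀ * G * S = G → Xᵀ * G + G * X = 0 := by
  obtain ⟨t, ht, u, hu⟩ := exists_isUnit_one_add_smul X
  obtain ⟨V, hV⟩ : ∃ V, V = (↑u⁻¹ : Matrix ι ι ℝ) := ⟨_, rfl⟩
  have hXu : Commute X (u : Matrix ι ι ℝ) := by
    rw [hu]
    exact (Commute.one_right X).add_right ((Commute.refl X).smul_right t)
  have hXV : Commute V X := hV ▸ hXu.units_inv_right.symm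
  have hSu : (1 - t • X) * V * (1 + t • X) = 1 - t • X := by
    rw [← hu, hV, mul_assoc, Units.inv_mul, mul_one]
  have hexp : ∀ G : Matrix ι ι ℝ, (1 + t • X)ᵀ * G * (1 + t • X) - (1 - t • X)ᵀ * G * (1 - t • X) =
      (2 * t) • (Xᵀ * G + G * X) := by
    intro G
    simp only [transpose_add, transpose_sub, transpose_one, transpose_smul, add_mul, sub_mul,
      mul_add, mul_sub, one_mul, mul_one, smul_mul_assoc, mul_smul_comm]
    module
  have hiff : ∀ G : Matrix ι ι ℝ, ((1 - t • X) * V)ᵀ * G * ((1 - t • X) * V) = G ↔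
      Xᵀ * G + G * X = 0 := by
    intro G
    have hut : IsUnit ((u : Matrix ι ι ℝ)ᵀ) := (isUnit_transpose _).2 u.isUnit
    rw [← hut.mul_right_inj, ← u.isUnit.mul_left_inj, hu]
    have h : (1 + t • X)ᵀ * (((1 - t • X) * V)ᵀ * G * ((1 - t • X) * V)) * (1 + t • X) =
        (1 - t • X)ᵀ * G * (1 - t • X) := by
      conv_rhs => rw [← hSu]
      simp only [transpose_mul, mul_assoc]
    rw [h, eq_comm, ← sub_eq_zero, hexp, smul_eq_zero_iff_right (by simpa using ht)]
  exact ⟨(1 - t • X) * V, ⟨(hiff Ω).2 hX,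
    (((Commute.one_left X).sub_left ((Commute.refl X).smul_left t)).mul_left hXV).eq⟩,
    fun G ↦ (hiff G).1⟩

theorem mem_isometryCentralizer_of_isCompatible (hskew : Ωᵀ = -Ω) (hJ : J * J = -1)
    (hJt : (Ω * J)ᵀ = Ω * J) (hXJ : X * J = J * X) : J ∈ isometryCentralizer Ω X := by
  refine ⟨?_, hXJ.symm⟩
  rw [transpose_mul_of_isCompatible hskew hJt, neg_mul, mul_assoc, hJ, mul_neg, mul_one, neg_neg]

theorem neg_mem_isometryCentralizer (hS : S ∈ isometryCentralizer Ω X) :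
    -S ∈ isometryCentralizer Ω X :=
  ⟨by simpa using hS.1, by simpa using hS.2⟩

theorem compatible_unique_of_isCompact (hskew : Ωᵀ = -Ω)
    (hK : IsCompact (isometryCentralizer Ω X : Set (Matrix ι ι ℝ)))
    (hJ : J * J = -1) (hJt : (Ω * J)ᵀ = Ω * J) (hJp : (Ω * J).PosDef) (hXJ : X * J = J * X)
    (hJ' : J' * J' = -1) (hJt' : (Ω * J')ᵀ = Ω * J') (hJp' : (Ω * J').PosDef)
    (hXJ' : X * J' = J' * X) : J' = J := by
  have hmem := mem_isometryCentralizer_of_isCompatible hskew hJ hJt hXJ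
  have hmem' := mem_isometryCentralizer_of_isCompatible hskew hJ' hJt' hXJ'
  have hJJ : ∀ Z, J * (J * Z) = -Z := fun Z ↦ by rw [← mul_assoc, hJ, neg_one_mul]
  have hJJ' : ∀ Z, J' * (J' * Z) = -Z := fun Z ↦ by rw [← mul_assoc, hJ', neg_one_mul]
  have hsq : (-(J * J')) * (-(J * J')) = 1 := by
    refine hJp.mul_self_eq_one_of_pow_mem (Q := -(J' * J)) ?_ ?_ hK
      (pow_mem (neg_mem_isometryCentralizer (mul_mem hmem hmem')))
      (pow_mem (neg_mem_isometryCentralizer (mul_mem hmem' hmem)))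
    · rw [transpose_neg, transpose_mul, neg_mul, mul_assoc, ← mul_assoc Jᵀ,
        transpose_mul_of_isCompatible hskew hJt]
      simp only [mul_assoc, hJ, hJJ, mul_neg, neg_mul, mul_one, neg_neg]
      rw [transpose_mul_of_isCompatible hskew hJt', neg_neg]
    · rw [neg_mul_neg]
      simp only [mul_assoc, hJJ', mul_neg, hJ, neg_neg]
  have hcomm : J * J' = J' * J := by
    have h := congrArg (fun Z ↦ J' * (J * Z)) hsq
    rw [neg_mul_neg] at h
    simpa only [mul_assoc, hJJ, hJJ', mul_neg, neg_neg, mul_one] using h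
  have hunit : IsUnit (J + J') := by
    have h := (hJp.add hJp').isUnit
    rw [← mul_add] at h
    exact isUnit_of_mul_isUnit_right h
  refine sub_eq_zero.1 (hunit.mul_left_eq_zero.1 ?_)
  rw [sub_mul, mul_add, mul_add, hJ, hJ', hcomm]
  abel

theorem exists_compatible_of_isCompact (hskew : Ωᵀ = -Ω) (hΩ : Ω * Ω = -1)
    (hX : Xᵀ * Ω + Ω * X = 0)
    (hK : IsCompact (isometryCentralizer Ω X : Set (Matrix ι ι ℝ))) :
    ∃ J : Matrix ι ι ℝ, J * J = -1 ∧ (Ω * J).PosDef ∧ X * J = J * X := by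
  obtain ⟨S, hS, hSX⟩ := exists_cayley_mem_isometryCentralizer hX
  obtain ⟨G, hG, hSG⟩ := exists_posDef_invariant hK
    (fun _ hs ↦ isUnit_of_mem_isometryCentralizer hΩ hs) (pow_mem hS)
  exact hG.exists_compatible_complex_structure hskew
    (IsUnit.of_mul_eq_one_right (-Ω) (by rw [neg_mul, hΩ, neg_neg])) hX (hSX G hSG)

theorem isCompact_orthogonal_posDef {G : Matrix ι ι ℝ} (hG : G.PosDef) :
    IsCompact {S : Matrix ι ι ℝ | Sᵀ * G * S = G} := by
  obtain ⟨B, hB, rfl, -⟩ := hG.exists_sqrt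
  have hBt : Bᵀ = B := by simpa using hB.isHermitian.eq
  obtain ⟨u, hu⟩ := hB.isUnit
  have hO : IsCompact (unitaryGroup ι ℝ : Set (Matrix ι ι ℝ)) := by
    refine IsCompact.of_isClosed_subset (s := Set.univ.pi fun _ ↦ Set.univ.pi fun _ ↦
      Metric.closedBall (0 : ℝ) 1)
      (isCompact_univ_pi fun _ ↦ isCompact_univ_pi fun _ ↦ isCompact_closedBall 0 1) ?_ ?_
    · have : (unitaryGroup ι ℝ : Set (Matrix ι ι ℝ)) = {U | star U * U = 1} := by
        ext U; exact mem_unitaryGroup_iff'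
      rw [this]
      exact isClosed_eq (by fun_prop) continuous_const
    · intro U hU i _ j _
      simpa using entry_norm_bound_of_unitary hU i j
  obtain ⟨C, hC⟩ : ∃ C, C = (↑u⁻¹ : Matrix ι ι ℝ) := ⟨_, rfl⟩
  have hCB : C * B = 1 := by rw [hC, ← hu, Units.inv_mul]
  have hBC : B * C = 1 := mul_eq_one_comm.1 hCB
  have hcont : Continuous fun U : Matrix ι ι ℝ ↦ C * U * B := by fun_prop
  refine (hO.image hcont).of_isClosed_subset
    (isClosed_eq (by fun_prop) continuous_const) fun S hS ↦ ⟨B * S * C, ?_, ?_⟩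
  · rw [SetLike.mem_coe, mem_unitaryGroup_iff', star_eq_conjTranspose,
      conjTranspose_eq_transpose_of_trivial]
    calc (B * S * C)ᵀ * (B * S * C) = Cᵀ * (Sᵀ * (B * B) * S) * C := by
          simp only [transpose_mul, hBt, mul_assoc]
      _ = (B * C)ᵀ * (B * C) := by
          rw [show Sᵀ * (B * B) * S = B * B from hS, transpose_mul, hBt]; simp only [mul_assoc]
      _ = 1 := by rw [hBC, transpose_one, one_mul]
  · calc C * (B * S * C) * B = (C * B) * S * (C * B) := by simp only [mul_assoc]
      _ = S := by rw [hCB, one_mul, mul_one]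

theorem isCompact_isometryCentralizer_of_unique (hΩ : Ω * Ω = -1)
    (hJ : J * J = -1) (hJp : (Ω * J).PosDef) (hXJ : X * J = J * X)
    (huniq : ∀ J' : Matrix ι ι ℝ, J' * J' = -1 ∧ (Ω * J')ᵀ = Ω * J' ∧ (Ω * J').PosDef ∧
      X * J' = J' * X → J' = J) :
    IsCompact (isometryCentralizer Ω X : Set (Matrix ι ι ℝ)) := by
  refine (isCompact_orthogonal_posDef hJp).of_isClosed_subset
    ((isClosed_eq (by fun_prop) continuous_const).inter
      (isClosed_eq (by fun_prop) (by fun_prop))) fun S hS ↦ ?_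
  obtain ⟨u, rfl⟩ := isUnit_of_mem_isometryCentralizer hΩ hS
  obtain ⟨V, hV⟩ : ∃ V, V = (↑u⁻¹ : Matrix ι ι ℝ) := ⟨_, rfl⟩
  obtain ⟨S, hSu⟩ : ∃ S, S = (↑u : Matrix ι ι ℝ) := ⟨_, rfl⟩
  have hXV : Commute X V := hV ▸ Commute.units_inv_right hS.2.symm
  have hSV : S * V = 1 := by rw [hSu, hV, Units.mul_inv]
  have hVS : V * S = 1 := mul_eq_one_comm.1 hSV
  rw [← hSu] at hS ⊢
  have hconj : Ω * (S * J * V) = Vᵀ * (Ω * J) * V := by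
    have h : Vᵀ * Ω = Ω * S := by
      have h1 : Vᵀ * Sᵀ = 1 := by
        rw [← transpose_mul, hSV, transpose_one]
      conv_lhs => rw [← hS.1]
      rw [← mul_assoc, ← mul_assoc, h1, one_mul]
    rw [← mul_assoc Vᵀ, h]
    simp only [mul_assoc]
  have hp : (Ω * (S * J * V)).PosDef := by
    rw [hconj, ← conjTranspose_eq_transpose_of_trivial]
    exact hJp.conjTranspose_mul_mul_same (mulVec_injective_of_isUnit (.of_mul_eq_one_right _ hSV))
  have hfix : S * J * V = J := by
    refine huniq _ ⟨?_, by simpa using hp.isHermitian.eq, hp, ?_⟩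
    · calc
        S * J * V * (S * J * V) = S * (J * J) * V := by
          rw [mul_assoc (S * J), mul_assoc S J V, ← mul_assoc V, hVS, one_mul]
          simp only [mul_assoc]
        _ = -1 := by rw [hJ, mul_neg_one, neg_mul, hSV]
    · exact ((show Commute X S from hS.2.symm).mul_right hXJ).mul_right hXV
  have hSJ : S * J = J * S := by
    conv_rhs => rw [← hfix, mul_assoc, hVS, mul_one]
  calc Sᵀ * (Ω * J) * S = Sᵀ * Ω * S * J := by
        simp only [mul_assoc, hSJ]
    _ = Ω * J := by rw [hS.1]

end Symplectic

theorem Omega_transpose (n : ℕ) : (Omega n)ᵀ = -Omega n := by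
  simp [Omega, fromBlocks_transpose, fromBlocks_neg]

theorem Omega_mul_self (n : ℕ) : Omega n * Omega n = -1 := by
  simp [Omega, fromBlocks_multiply, ← fromBlocks_one, fromBlocks_neg]

/-- An element `X ∈ sp(2n,ℝ)` has compact centralizer in `Sp(2n,ℝ)`
iff there is exactly one matrix `J` with `J² = -I`, `ΩJ` symmetric positive definite,
and `XJ = JX`; i.e. iff `X` leaves invariant a unique compatible positive complex
structure on `ℝ²ⁿ`. -/
theorem stronglyStable_iff_unique_compatible_complex_structure (n : ℕ)
    (X : Matrix (Fin n ⊕ Fin n) (Fin n ⊕ Fin n) ℝ) (hX : X ∈ sp n) :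
    IsCompact {S ∈ Sp n | S * X = X * S} ↔
      ∃! J : Matrix (Fin n ⊕ Fin n) (Fin n ⊕ Fin n) ℝ,
        J * J = -1 ∧ (Omega n * J)ᵀ = Omega n * J ∧ (Omega n * J).PosDef ∧
          X * J = J * X := by
  change IsCompact (SetLike.coe (isometryCentralizer (Omega n) X)) ↔ _
  refine ⟨fun hK ↦ ?_, ?_⟩
  · obtain ⟨J, hJ, hJp, hXJ⟩ :=
      exists_compatible_of_isCompact (Omega_transpose n) (Omega_mul_self n) hX hK
    have hJt : (Omega n * J)ᵀ = Omega n * J := by simpa using hJp.isHermitian.eq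
    refine ⟨J, ⟨hJ, hJt, hJp, hXJ⟩, ?_⟩
    rintro J' ⟨hJ', hJt', hJp', hXJ'⟩
    exact compatible_unique_of_isCompact (Omega_transpose n) hK hJ hJt hJp hXJ hJ' hJt' hJp' hXJ'
  · rintro ⟨J, ⟨hJ, -, hJp, hXJ⟩, huniq⟩
    exact isCompact_isometryCentralizer_of_unique (Omega_mul_self n) hJ hJp hXJ huniq
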